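/- For every real number a > 0, every positive integer k and every x > 0, one has the identity f_k'(x)·a·coth(a·x) - f_k''(x) = (a·(k+1)/k)·sinh(a·x)²·(cosh(a·x))^(-(2k+1)/k); in particular f_k'(x)·μ_θ(x) - f_k''(x) > 0 for every x > 0. -/

import Mathlib

/-- The comparison function `f_k(x) = -(k/a)·(cosh(a·x))^(-1/k)`. -/
noncomputable def fcomp (a : ℝ) (k : ℕ) : ℝ → ℝ :=
  fun x => -((k : ℝ) / a) * Real.cosh (a * x) ^ (-(1 : ℝ) / (k : ℝ))

theorem hasDerivAt_cosh_mul_rpow (a p x : ℝ) :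
    HasDerivAt (fun y => Real.cosh (a * y) ^ p)
      (Real.sinh (a * x) * a * p * Real.cosh (a * x) ^ (p - 1)) x := by
  have h : HasDerivAt (fun y : ℝ => a * y) a x := by
    simpa using (hasDerivAt_id x).const_mul a
  exact h.cosh.rpow_const (Or.inl (Real.cosh_pos _).ne')

theorem deriv_fcomp {a : ℝ} (ha : a ≠ 0) {k : ℕ} (hk : k ≠ 0) :
    deriv (fcomp a k) =
      fun x => Real.sinh (a * x) * Real.cosh (a * x) ^ (-(1 : ℝ) / (k : ℝ) - 1) := by
  have hk' : (k : ℝ) ≠ 0 := Nat.cast_ne_zero.mpr hk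
  funext x
  have h := (hasDerivAt_cosh_mul_rpow a (-(1 : ℝ) / (k : ℝ)) x).const_mul (-((k : ℝ) / a))
  refine (HasDerivAt.deriv h).trans ?_
  field_simp

theorem deriv_sinh_mul_cosh_rpow (a p x : ℝ) :
    deriv (fun y => Real.sinh (a * y) * Real.cosh (a * y) ^ p) x =
      a * Real.cosh (a * x) * Real.cosh (a * x) ^ p +
        a * p * Real.sinh (a * x) ^ 2 * Real.cosh (a * x) ^ (p - 1) := by
  have h : HasDerivAt (fun y : ℝ => a * y) a x := by
    simpa using (hasDerivAt_id x).const_mul a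
  refine (h.sinh.mul (hasDerivAt_cosh_mul_rpow a p x)).deriv.trans ?_
  ring

theorem stmt_5 (a : ℝ) (ha : 0 < a) (k : ℕ) (hk : 0 < k) (x : ℝ) (hx : 0 < x) :
    deriv (fcomp a k) x * (a * (Real.cosh (a * x) / Real.sinh (a * x)))
        - deriv (deriv (fcomp a k)) x
      = (a * ((k : ℝ) + 1) / (k : ℝ)) * Real.sinh (a * x) ^ 2 *
          Real.cosh (a * x) ^ (-(2 * (k : ℝ) + 1) / (k : ℝ)) ∧
    0 < deriv (fcomp a k) x * (a * (Real.cosh (a * x) / Real.sinh (a * x)))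
        - deriv (deriv (fcomp a k)) x := by
  have hk' : (0 : ℝ) < k := Nat.cast_pos.mpr hk
  have hs : 0 < Real.sinh (a * x) := Real.sinh_pos_iff.mpr (mul_pos ha hx)
  have hc : 0 < Real.cosh (a * x) := Real.cosh_pos _
  have key : deriv (fcomp a k) x * (a * (Real.cosh (a * x) / Real.sinh (a * x)))
        - deriv (deriv (fcomp a k)) x
      = (a * ((k : ℝ) + 1) / (k : ℝ)) * Real.sinh (a * x) ^ 2 *
          Real.cosh (a * x) ^ (-(2 * (k : ℝ) + 1) / (k : ℝ)) := by
    have he : -(2 * (k : ℝ) + 1) / (k : ℝ) = -(1 : ℝ) / (k : ℝ) - 1 - 1 := by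
      field_simp
      ring
    rw [deriv_fcomp ha.ne' hk.ne', deriv_sinh_mul_cosh_rpow, he]
    beta_reduce
    generalize Real.cosh (a * x) ^ (-(1 : ℝ) / (k : ℝ) - 1 - 1) = u
    generalize Real.cosh (a * x) ^ (-(1 : ℝ) / (k : ℝ) - 1) = v
    field_simp
    ring
  refine ⟨key, key ▸ ?_⟩
  positivity
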